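/- Fix distinct positive reals μ_1, ..., μ_M and for m > M define the sequence w^{(m)} by: w^{(m)}_n = (−1)^{M−n+1} (n!/m!) s_{α(m−M, M−n)}(μ_1,...,μ_M) for 1 ≤ n ≤ M, w^{(m)}_m = 1, and w^{(m)}_n = 0 otherwise. Then for every i ∈ {1,...,M}, ∑_{n=1}^∞ (μ_i^n / n!) w^{(m)}_n = 0. -/

import Mathlib

/-- The set of cells of the Young diagram with row lengths given by `lam`. -/
def youngCells (lam : List ℕ) : Finset (ℕ × ℕ) :=
  (Finset.range lam.length).biUnion fun i => {i} ×ˢ Finset.range (lam.getD i 0)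

/-- The Schur polynomial `s_lam` in `M` variables, evaluated at `μ`, defined
combinatorially as the sum over semistandard fillings of the diagram `lam`
with entries in `Fin M` of the corresponding monomials. -/
noncomputable def schur (M : ℕ) (μ : Fin M → ℝ) (lam : List ℕ) : ℝ :=
  ∑ T : youngCells lam → Fin M,
    if (∀ c c' : youngCells lam,
          (c : ℕ × ℕ).1 = (c' : ℕ × ℕ).1 → (c : ℕ × ℕ).2 + 1 = (c' : ℕ × ℕ).2 → T c ≤ T c') ∧
       (∀ c c' : youngCells lam,
          (c : ℕ × ℕ).1 + 1 = (c' : ℕ × ℕ).1 → (c : ℕ × ℕ).2 = (c' : ℕ × ℕ).2 → T c < T c')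
    then ∏ c : youngCells lam, μ (T c) else 0

theorem mem_youngCells_hook (a b : ℕ) (x : ℕ × ℕ) :
    x ∈ youngCells ((a + 1) :: List.replicate b 1) ↔
      (x.1 = 0 ∧ x.2 < a + 1) ∨ (1 ≤ x.1 ∧ x.1 < b + 1 ∧ x.2 = 0) := by
  obtain ⟨i, j⟩ := x
  simp only [youngCells, Finset.mem_biUnion, Finset.mem_range, List.length_cons,
    List.length_replicate, Finset.mem_product, Finset.mem_singleton]
  constructor
  · rintro ⟨k, hk, rfl, hj⟩
    cases i with
    | zero => left; simpa using hj
    | succ i =>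
      right
      have : i < b := by omega
      simp [this] at hj
      omega
  · rintro (⟨rfl, h⟩ | ⟨h1, h2, rfl⟩)
    · exact ⟨0, by omega, rfl, by simpa using h⟩
    · refine ⟨i, h2, rfl, ?_⟩
      cases i with
      | zero => omega
      | succ i =>
        have : i < b := by omega
        simp [this]

/-- A Schur polynomial can be computed along any enumeration of the cells of its diagram. -/
theorem schur_eq_sum_of_enum {ι : Type*} [Fintype ι] [DecidableEq ι] (M : ℕ) (μ : Fin M → ℝ)
    (lam : List ℕ) (p : ι → ℕ × ℕ) (hp : Function.Injective p)
    (hmem : ∀ x, x ∈ youngCells lam ↔ ∃ i, p i = x)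
    (P : (ι → Fin M) → Prop) [DecidablePred P]
    (hP : ∀ T : ι → Fin M,
      ((∀ i j, (p i).1 = (p j).1 → (p i).2 + 1 = (p j).2 → T i ≤ T j) ∧
       (∀ i j, (p i).1 + 1 = (p j).1 → (p i).2 = (p j).2 → T i < T j)) ↔ P T) :
    schur M μ lam = ∑ T : ι → Fin M, if P T then ∏ i, μ (T i) else 0 := by
  let e : ι ≃ youngCells lam := Equiv.ofBijective (fun i => ⟨p i, (hmem _).2 ⟨i, rfl⟩⟩)
    ⟨fun i j h => hp (congrArg Subtype.val h), fun x => by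
      obtain ⟨i, hi⟩ := (hmem x).1 x.2
      exact ⟨i, Subtype.ext hi⟩⟩
  have he : ∀ i, ((e i : youngCells lam) : ℕ × ℕ) = p i := fun i => rfl
  unfold schur
  symm
  refine Fintype.sum_equiv (Equiv.arrowCongr e (Equiv.refl (Fin M))) _ _ fun T => ?_
  have hT : ∀ i, (Equiv.arrowCongr e (Equiv.refl (Fin M))) T (e i) = T i := fun i => by simp
  refine if_congr ?_ ?_ rfl
  · simp only [← hP, ← e.forall_congr_right, hT, he]
  · rw [← e.prod_comp]
    simp only [hT]

/-- Weakly increasing along consecutive indices. -/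
def IsRow {M a : ℕ} (r : Fin a → Fin M) : Prop :=
  ∀ i j : Fin a, (i : ℕ) + 1 = j → r i ≤ r j

/-- Strictly increasing along consecutive indices. -/
def IsCol {M b : ℕ} (c : Fin b → Fin M) : Prop :=
  ∀ i j : Fin b, (i : ℕ) + 1 = j → c i < c j

theorem IsCol.strictMono {M b : ℕ} {c : Fin b → Fin M} (h : IsCol c) : StrictMono c := by
  cases b with
  | zero => exact fun i => i.elim0
  | succ b => exact Fin.strictMono_iff_lt_succ.2 fun i => h _ _ (by simp)

theorem isCol_iff_strictMono {M b : ℕ} {c : Fin b → Fin M} : IsCol c ↔ StrictMono c :=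
  ⟨IsCol.strictMono, fun h i j hij => h (by rw [Fin.lt_def]; omega)⟩

open Classical in
/-- The complete homogeneous symmetric polynomial as a sum over rows. -/
noncomputable def rowSum (M : ℕ) (μ : Fin M → ℝ) (a : ℕ) : ℝ :=
  ∑ r : Fin a → Fin M, if IsRow r then ∏ i, μ (r i) else 0

open Classical in
/-- The elementary symmetric polynomial as a sum over columns. -/
noncomputable def colSum (M : ℕ) (μ : Fin M → ℝ) (b : ℕ) : ℝ :=
  ∑ c : Fin b → Fin M, if IsCol c then ∏ i, μ (c i) else 0

theorem schur_row (M : ℕ) (μ : Fin M → ℝ) (a : ℕ) :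
    schur M μ [a + 1] = rowSum M μ (a + 1) := by
  classical
  rw [schur_eq_sum_of_enum M μ [a + 1] (fun i : Fin (a + 1) => ((0, i) : ℕ × ℕ))
    (fun i j h => by simpa [Fin.ext_iff] using h)
    (fun x => (mem_youngCells_hook a 0 x).trans ?_) IsRow (fun r => by simp [IsRow])]
  · rfl
  · constructor
    · rintro (⟨h1, h2⟩ | h)
      · exact ⟨⟨x.2, h2⟩, Prod.ext h1.symm rfl⟩
      · omega
    · rintro ⟨i, rfl⟩
      exact Or.inl ⟨rfl, i.2⟩

theorem schur_col (M : ℕ) (μ : Fin M → ℝ) (b : ℕ) :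
    schur M μ (1 :: List.replicate b 1) = colSum M μ (b + 1) := by
  classical
  rw [schur_eq_sum_of_enum M μ _ (fun i : Fin (b + 1) => ((i, 0) : ℕ × ℕ))
    (fun i j h => by simpa [Fin.ext_iff] using h)
    (fun x => (mem_youngCells_hook 0 b x).trans ?_) IsCol (fun c => by simp [IsCol])]
  · rfl
  · constructor
    · intro h
      exact ⟨⟨x.1, by omega⟩, Prod.ext rfl (by dsimp only; omega)⟩
    · rintro ⟨i, rfl⟩
      dsimp only
      omega

open Classical in
/-- Hook tableaux, with the corner cell regarded as part of the row. -/
theorem schur_hook_corner_in_row (M : ℕ) (μ : Fin M → ℝ) (a b : ℕ) :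
    schur M μ ((a + 1) :: List.replicate (b + 1) 1) =
      ∑ r : Fin (a + 1) → Fin M, ∑ c : Fin (b + 1) → Fin M,
        if IsRow r ∧ IsCol c ∧ r 0 < c 0 then (∏ i, μ (r i)) * ∏ i, μ (c i) else 0 := by
  rw [schur_eq_sum_of_enum M μ _
    (Sum.elim (fun i => (0, i)) (fun i => (i + 1, 0)) : Fin (a + 1) ⊕ Fin (b + 1) → ℕ × ℕ)
    ?_ (fun x => (mem_youngCells_hook a (b + 1) x).trans ?_)
    (fun T => IsRow (fun i => T (Sum.inl i)) ∧ IsCol (fun i => T (Sum.inr i)) ∧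
      T (Sum.inl 0) < T (Sum.inr 0)) fun T => ?_]
  · rw [← (Equiv.sumArrowEquivProdArrow _ _ _).symm.sum_comp, Fintype.sum_prod_type]
    simp [Fintype.prod_sum_type, Equiv.sumArrowEquivProdArrow]
  · rintro (i | i) (j | j) h
    all_goals
      obtain ⟨h1, h2⟩ := Prod.ext_iff.1 h
      simp only [Sum.elim_inl, Sum.elim_inr] at h1 h2
    · exact congrArg Sum.inl (Fin.ext (by omega))
    · omega
    · omega
    · exact congrArg Sum.inr (Fin.ext (by omega))
  · constructor
    · rintro (⟨h1, h2⟩ | ⟨h1, h2, h3⟩)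
      · exact ⟨Sum.inl ⟨x.2, h2⟩, Prod.ext h1.symm rfl⟩
      · exact ⟨Sum.inr ⟨x.1 - 1, by omega⟩, Prod.ext (Nat.sub_add_cancel h1) h3.symm⟩
    · rintro ⟨i | i, rfl⟩
      · exact Or.inl ⟨rfl, i.2⟩
      · exact Or.inr ⟨Nat.succ_pos _, Nat.succ_lt_succ i.2, rfl⟩
  · simp only [Sum.forall, Sum.elim_inl, Sum.elim_inr]
    constructor
    · rintro ⟨⟨h1, h2⟩, h3⟩
      refine ⟨fun i j h => (h1 i).1 j trivial h, fun i j h => (h3.2 i).2 j (by omega) trivial,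
        (h3.1 0).2 0 rfl rfl⟩
    · rintro ⟨hr, hc, h0⟩
      refine ⟨⟨fun i => ⟨fun j _ h => hr i j h, fun j h => by omega⟩,
        fun i => ⟨fun j h => by omega, fun j _ h => by omega⟩⟩,
        fun i => ⟨fun j h => by omega, fun j h h' => ?_⟩,
        fun i => ⟨fun j h => by omega, fun j h _ => hc i j (by omega)⟩⟩
      obtain rfl : i = 0 := Fin.ext h'
      obtain rfl : j = 0 := Fin.ext (by rw [Fin.val_zero] at *; omega)
      exact h0

open Classical in
/-- Hook tableaux, with the corner cell regarded as part of the column. -/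
theorem schur_hook_corner_in_col (M : ℕ) (μ : Fin M → ℝ) (a b : ℕ) :
    schur M μ ((a + 2) :: List.replicate b 1) =
      ∑ r : Fin (a + 1) → Fin M, ∑ c : Fin (b + 1) → Fin M,
        if IsRow r ∧ IsCol c ∧ c 0 ≤ r 0 then (∏ i, μ (r i)) * ∏ i, μ (c i) else 0 := by
  rw [schur_eq_sum_of_enum M μ _
    (Sum.elim (fun i => (0, i + 1)) (fun i => (i, 0)) : Fin (a + 1) ⊕ Fin (b + 1) → ℕ × ℕ)
    ?_ (fun x => (mem_youngCells_hook (a + 1) b x).trans ?_)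
    (fun T => IsRow (fun i => T (Sum.inl i)) ∧ IsCol (fun i => T (Sum.inr i)) ∧
      T (Sum.inr 0) ≤ T (Sum.inl 0)) fun T => ?_]
  · rw [← (Equiv.sumArrowEquivProdArrow _ _ _).symm.sum_comp, Fintype.sum_prod_type]
    simp [Fintype.prod_sum_type, Equiv.sumArrowEquivProdArrow]
  · rintro (i | i) (j | j) h
    all_goals
      obtain ⟨h1, h2⟩ := Prod.ext_iff.1 h
      simp only [Sum.elim_inl, Sum.elim_inr] at h1 h2
    · exact congrArg Sum.inl (Fin.ext (by omega))
    · omega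
    · omega
    · exact congrArg Sum.inr (Fin.ext (by omega))
  · constructor
    · intro h
      by_cases h0 : x.2 = 0
      · exact ⟨Sum.inr ⟨x.1, by omega⟩, Prod.ext rfl h0.symm⟩
      · have h1 : 0 = x.1 := by omega
        exact ⟨Sum.inl ⟨x.2 - 1, by omega⟩, Prod.ext h1 (Nat.sub_add_cancel (by omega))⟩
    · rintro ⟨i | i, rfl⟩
      · exact Or.inl ⟨rfl, Nat.succ_lt_succ i.2⟩
      · have := i.2
        simp only [Sum.elim_inr, and_true]
        omega
  · simp only [Sum.forall, Sum.elim_inl, Sum.elim_inr]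
    constructor
    · rintro ⟨⟨h1, h2⟩, h3⟩
      refine ⟨fun i j h => (h1 i).1 j trivial (by omega), fun i j h => (h3.2 i).2 j h trivial,
        (h2 0).1 0 rfl rfl⟩
    · rintro ⟨hr, hc, h0⟩
      refine ⟨⟨fun i => ⟨fun j _ h => hr i j (by omega), fun j _ h => by omega⟩,
        fun i => ⟨fun j h h' => ?_, fun j _ h => by omega⟩⟩,
        fun i => ⟨fun j h => by omega, fun j _ h => by omega⟩,
        fun i => ⟨fun j h => by omega, fun j h _ => hc i j h⟩⟩
      obtain rfl : i = 0 := Fin.ext h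
      obtain rfl : j = 0 := Fin.ext (by rw [Fin.val_zero] at *; omega)
      exact h0

/-- Pieri's rule for the product of a row and a column. -/
theorem schur_hook_add_schur_hook (M : ℕ) (μ : Fin M → ℝ) (a b : ℕ) :
    schur M μ ((a + 1) :: List.replicate (b + 1) 1) + schur M μ ((a + 2) :: List.replicate b 1) =
      rowSum M μ (a + 1) * colSum M μ (b + 1) := by
  classical
  rw [schur_hook_corner_in_row, schur_hook_corner_in_col, rowSum, colSum, Finset.sum_mul_sum]
  simp only [← Finset.sum_add_distrib]
  refine Finset.sum_congr rfl fun r _ => Finset.sum_congr rfl fun c _ => ?_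
  by_cases hr : IsRow r <;> by_cases hc : IsCol c <;> by_cases h : r 0 < c 0 <;>
    simp [hr, hc, h, not_le.2, not_lt.1]

theorem schur_hook_eq_zero (M : ℕ) (μ : Fin M → ℝ) (a : ℕ) :
    schur M μ ((a + 1) :: List.replicate M 1) = 0 := by
  classical
  have hc : ∀ c : Fin (M + 1) → Fin M, ¬ IsCol c := fun c hc => by
    simpa using Fintype.card_le_of_injective c hc.strictMono.injective
  cases a with
  | zero => simp [schur_col, colSum, hc]
  | succ a => simp [schur_hook_corner_in_col, hc]

theorem colSum_eq_sum_powersetCard (M : ℕ) (μ : Fin M → ℝ) (b : ℕ) :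
    colSum M μ b = ∑ t ∈ Finset.powersetCard b Finset.univ, ∏ i ∈ t, μ i := by
  classical
  rw [colSum, ← Finset.sum_filter]
  refine Finset.sum_bij (fun c _ => Finset.univ.image c) ?_ ?_ ?_ ?_
  · intro c hc
    have hc := (isCol_iff_strictMono.1 (Finset.mem_filter.1 hc).2).injective
    simp [Finset.mem_powersetCard, Finset.card_image_of_injective _ hc]
  · intro c hc d hd h
    have hc := isCol_iff_strictMono.1 (Finset.mem_filter.1 hc).2
    have hd := isCol_iff_strictMono.1 (Finset.mem_filter.1 hd).2
    refine (hc.range_inj hd).1 ?_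
    simpa using congrArg (fun s : Finset (Fin M) => (s : Set (Fin M))) h
  · intro t ht
    have ht := (Finset.mem_powersetCard.1 ht).2
    refine ⟨t.orderEmbOfFin ht, ?_, ?_⟩
    · simp [isCol_iff_strictMono, (t.orderEmbOfFin ht).strictMono]
    · simp
  · intro c hc
    have hc := (isCol_iff_strictMono.1 (Finset.mem_filter.1 hc).2).injective
    rw [Finset.prod_image fun i _ j _ h => hc h]

theorem sum_colSum_eq_prod (M : ℕ) (μ : Fin M → ℝ) (x : ℝ) :
    ∑ b ∈ Finset.range (M + 1), (-1) ^ b * colSum M μ b * x ^ (M - b) = ∏ i, (x - μ i) := by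
  classical
  have h : ∏ i, (x - μ i) = ∏ i, (-μ i + x) := Finset.prod_congr rfl fun i _ => by ring
  rw [h, Finset.prod_add, Finset.sum_powerset]
  simp only [Finset.card_univ, Fintype.card_fin]
  refine Finset.sum_congr rfl fun b _ => ?_
  rw [colSum_eq_sum_powersetCard, Finset.mul_sum, Finset.sum_mul]
  refine Finset.sum_congr rfl fun t ht => ?_
  have ht := (Finset.mem_powersetCard.1 ht).2
  rw [Finset.prod_neg, Finset.prod_const, ← Finset.compl_eq_univ_sdiff, Finset.card_compl, ht,
    Fintype.card_fin]

theorem sum_colSum_succ (M : ℕ) (μ : Fin M → ℝ) (i : Fin M) :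
    ∑ b ∈ Finset.range M, (-1) ^ b * colSum M μ (b + 1) * μ i ^ (M - b) = μ i ^ (M + 1) := by
  have h := sum_colSum_eq_prod M μ (μ i)
  have h0 : colSum M μ 0 = 1 := by simp [colSum_eq_sum_powersetCard]
  rw [Finset.prod_eq_zero (Finset.mem_univ i) (sub_self _), Finset.sum_range_succ', h0] at h
  have h2 : ∑ b ∈ Finset.range M, (-1) ^ b * colSum M μ (b + 1) * μ i ^ (M - b) =
      -μ i * ∑ b ∈ Finset.range M, (-1) ^ (b + 1) * colSum M μ (b + 1) * μ i ^ (M - (b + 1)) := by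
    rw [Finset.mul_sum]
    refine Finset.sum_congr rfl fun b hb => ?_
    have : M - b = M - (b + 1) + 1 := by have := Finset.mem_range.1 hb; omega
    rw [this]
    ring
  rw [h2, eq_neg_of_add_eq_zero_left h]
  simp
  ring

/-- Reduction of a power of one of the variables modulo `∏ j, (X - μ j)`. -/
theorem sum_schur_hook (M : ℕ) (μ : Fin M → ℝ) (i : Fin M) (a : ℕ) :
    ∑ b ∈ Finset.range M, (-1) ^ b * schur M μ ((a + 1) :: List.replicate b 1) * μ i ^ (M - b) =
      μ i ^ (M + a + 1) := by
  induction a with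
  | zero => simpa [schur_col] using sum_colSum_succ M μ i
  | succ a ih =>
    have h1 : ∀ b, schur M μ ((a + 1 + 1) :: List.replicate b 1) =
        rowSum M μ (a + 1) * colSum M μ (b + 1) -
          schur M μ ((a + 1) :: List.replicate (b + 1) 1) := fun b =>
      eq_sub_of_add_eq' (schur_hook_add_schur_hook M μ a b)
    have h2 : ∑ b ∈ Finset.range M,
        (-1) ^ (b + 1) * schur M μ ((a + 1) :: List.replicate (b + 1) 1) * μ i ^ (M - (b + 1)) =
        μ i ^ (M + a + 1) - rowSum M μ (a + 1) * μ i ^ M := by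
      have h := Finset.sum_range_succ' (fun b =>
        (-1) ^ b * schur M μ ((a + 1) :: List.replicate b 1) * μ i ^ (M - b)) M
      rw [Finset.sum_range_succ, ih, schur_hook_eq_zero] at h
      simp only [List.replicate_zero, schur_row] at h
      simp at h ⊢
      linarith
    have h3 : ∀ b ∈ Finset.range M,
        (-1) ^ b * schur M μ ((a + 1 + 1) :: List.replicate b 1) * μ i ^ (M - b) =
        rowSum M μ (a + 1) * ((-1) ^ b * colSum M μ (b + 1) * μ i ^ (M - b)) + μ i *
          ((-1) ^ (b + 1) * schur M μ ((a + 1) :: List.replicate (b + 1) 1) *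
            μ i ^ (M - (b + 1))) := fun b hb => by
      have : M - b = M - (b + 1) + 1 := by have := Finset.mem_range.1 hb; omega
      rw [h1, this]
      ring
    rw [Finset.sum_congr rfl h3, Finset.sum_add_distrib, ← Finset.mul_sum, ← Finset.mul_sum, h2,
      sum_colSum_succ]
    ring

/-- The difference vectors `w^(m)`, built from hook-shaped Schur polynomials,
satisfy all the decoy constraints: `∑_{n≥1} (μ i ^ n / n!) w n = 0` for each `i`. -/
theorem w_satisfies_constraints (M m : ℕ) (hM : 0 < M) (hm : M < m)
    (μ : Fin M → ℝ) (hpos : ∀ i, 0 < μ i) (hinj : Function.Injective μ)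
    (w : ℕ → ℝ)
    (hw_low : ∀ n, 1 ≤ n → n ≤ M → w n =
      (-1 : ℝ) ^ (M - n + 1) * ((n.factorial : ℝ) / (m.factorial : ℝ)) *
        schur M μ ((m - M) :: List.replicate (M - n) 1))
    (hw_m : w m = 1)
    (hw_zero : ∀ n, M < n → n ≠ m → w n = 0) :
    ∀ i : Fin M, ∑' n : ℕ, (μ i ^ (n + 1) / ((n + 1).factorial : ℝ)) * w (n + 1) = 0 := by
  intro i
  obtain ⟨a, rfl⟩ : ∃ a, m = M + a + 1 := ⟨m - M - 1, by omega⟩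
  have hfact : ∀ n : ℕ, (n.factorial : ℝ) ≠ 0 := fun n => by positivity
  have hsupp : ∀ n ∉ Finset.range (M + a + 1),
      (μ i ^ (n + 1) / ((n + 1).factorial : ℝ)) * w (n + 1) = 0 := fun n hn => by
    have hn := Finset.mem_range.not.1 hn
    rw [hw_zero (n + 1) (by omega) (by omega), mul_zero]
  have hmid : ∑ n ∈ Finset.range a,
      (μ i ^ (M + n + 1) / ((M + n + 1).factorial : ℝ)) * w (M + n + 1) = 0 :=
    Finset.sum_eq_zero fun n hn => by
      have hn := Finset.mem_range.1 hn
      rw [hw_zero (M + n + 1) (by omega) (by omega), mul_zero]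
  rw [tsum_eq_sum hsupp, Finset.sum_range_succ, Finset.sum_range_add, hmid, hw_m,
    ← Finset.sum_range_reflect]
  have hlow : ∀ b ∈ Finset.range M,
      (μ i ^ (M - 1 - b + 1) / ((M - 1 - b + 1).factorial : ℝ)) * w (M - 1 - b + 1) =
      -(1 / ((M + a + 1).factorial : ℝ)) *
        ((-1) ^ b * schur M μ ((a + 1) :: List.replicate b 1) * μ i ^ (M - b)) := fun b hb => by
    have hb := Finset.mem_range.1 hb
    have e1 : M - 1 - b + 1 = M - b := by omega
    have e2 : M - (M - b) = b := by omega
    have e3 : M + a + 1 - M = a + 1 := by omega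
    rw [e1, hw_low (M - b) (by omega) (by omega), e2, e3]
    have := hfact (M - b)
    have := hfact (M + a + 1)
    field_simp
    ring
  rw [Finset.sum_congr rfl hlow, ← Finset.mul_sum, sum_schur_hook]
  ring
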